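/- (Desnanot–Jacobi identity.) Let R be a commutative ring, let n ≥ 1, and let A = (A[i,j])_{i,j=0}^{n} be an (n+1)×(n+1) matrix over R. Then (det A)·(det A_{0,n}^{0,n}) = (det A_0^0)·(det A_n^n) − (det A_0^n)·(det A_n^0), where A_j^i denotes the matrix A with row i and column j deleted, and A_{0,n}^{0,n} denotes A with rows 0 and n and columns 0 and n deleted. -/

import Mathlib

namespace Matrix

variable {R : Type*} [CommRing R]

/-- The determinant of the identity matrix with two columns replaced. -/
theorem det_one_updateCol_updateCol {m : Type*} [Fintype m] [DecidableEq m] {i j : m}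
    (hij : i ≠ j) (v w : m → R) :
    (((1 : Matrix m m R).updateCol i v).updateCol j w).det = v i * w j - w i * v j := by
  have h : ((1 : Matrix m m R).updateCol i v).updateCol j w =
      1 + (of ![v - Pi.single i 1, w - Pi.single j 1] : Matrix (Fin 2) m R)ᵀ *
        (of ![Pi.single i 1, Pi.single j 1] : Matrix (Fin 2) m R) := by
    ext k l
    simp only [updateCol_apply, add_apply, mul_apply, transpose_apply, Fin.sum_univ_two,
      of_apply, cons_val_zero, cons_val_one, Pi.sub_apply, Pi.single_apply, one_apply]
    split_ifs <;> simp_all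
  rw [h, det_one_add_mul_comm, det_fin_two]
  simp [hij, hij.symm]

theorem det_updateCol_single {n : ℕ} (A : Matrix (Fin (n + 1)) (Fin (n + 1)) R)
    (i j : Fin (n + 1)) (r : R) :
    (A.updateCol j (Pi.single i r)).det =
      r * ((-1) ^ (i + j : ℕ) * (A.submatrix i.succAbove j.succAbove).det) := by
  rw [← cramer_apply, cramer_eq_adjugate_mulVec, mulVec_single,
    ← adjugate_fin_succ_eq_det_submatrix]
  simp [mul_comm]

theorem det_updateCol_zero_updateCol_last {n : ℕ} (A : Matrix (Fin (n + 2)) (Fin (n + 2)) R)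
    (r s : R) :
    ((A.updateCol 0 (Pi.single 0 r)).updateCol (Fin.last (n + 1))
        (Pi.single (Fin.last (n + 1)) s)).det =
      r * s * (A.submatrix (fun k : Fin n => k.succ.castSucc)
        (fun k : Fin n => k.succ.castSucc)).det := by
  have h : (A.updateCol 0 (Pi.single 0 r)).submatrix (Fin.last (n + 1)).succAbove
      (Fin.last (n + 1)).succAbove =
      (A.submatrix Fin.castSucc Fin.castSucc).updateCol 0 (Pi.single 0 r) := by
    ext k l
    simp [updateCol_apply, Pi.single_apply]
  rw [det_updateCol_single, h, det_updateCol_single, submatrix_submatrix, Even.neg_one_pow ⟨_, rfl⟩,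
    Even.neg_one_pow ⟨_, rfl⟩]
  simp only [Fin.succAbove_zero, Function.comp_def]
  ring

theorem mulVec_adjugate_col {m : Type*} [Fintype m] [DecidableEq m] (A : Matrix m m R) (j : m) :
    A *ᵥ A.adjugate.col j = Pi.single j A.det := by
  ext i
  have := congr_fun₂ A.mul_adjugate i j
  simpa [mul_apply, mulVec, dotProduct, one_apply, Pi.single_apply] using this

/-- The Desnanot–Jacobi identity multiplied by `det A`. -/
theorem det_mul_desnanot_jacobi {n : ℕ} (A : Matrix (Fin (n + 2)) (Fin (n + 2)) R) :
    A.det * (A.det * (A.submatrix (fun k : Fin n => k.succ.castSucc)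
        (fun k : Fin n => k.succ.castSucc)).det) =
      A.det * ((A.submatrix (Fin.succAbove 0) (Fin.succAbove 0)).det *
          (A.submatrix (Fin.succAbove (Fin.last (n + 1)))
            (Fin.succAbove (Fin.last (n + 1)))).det -
        (A.submatrix (Fin.succAbove (Fin.last (n + 1))) (Fin.succAbove 0)).det *
          (A.submatrix (Fin.succAbove 0) (Fin.succAbove (Fin.last (n + 1)))).det) := by
  have key := det_mul A (((1 : Matrix _ _ R).updateCol 0 (A.adjugate.col 0)).updateCol
    (Fin.last (n + 1)) (A.adjugate.col (Fin.last (n + 1))))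
  rw [mul_updateCol, mul_updateCol, mul_one, mulVec_adjugate_col, mulVec_adjugate_col,
    det_updateCol_zero_updateCol_last,
    det_one_updateCol_updateCol (Fin.last_pos (n := n)).ne] at key
  rw [← mul_assoc, key]
  simp only [col_apply, adjugate_fin_succ_eq_det_submatrix, Fin.val_zero, Fin.val_last, add_zero,
    zero_add, pow_zero, one_mul, Even.neg_one_pow ⟨n + 1, rfl⟩]
  congr 2
  rw [mul_mul_mul_comm, ← pow_add, Even.neg_one_pow ⟨n + 1, rfl⟩, one_mul]

end Matrix

/-- The Desnanot–Jacobi identity: for an `(n+2) × (n+2)` matrix `A` over a commutative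
ring (rows and columns indexed by `0,…,n+1`),
`det A · det A_{0,n+1}^{0,n+1} = det A_0^0 · det A_{n+1}^{n+1} − det A_0^{n+1} · det A_{n+1}^0`,
where sub/superscripts denote deleted columns/rows. -/
theorem desnanot_jacobi {R : Type*} [CommRing R] (n : ℕ)
    (A : Matrix (Fin (n + 2)) (Fin (n + 2)) R) :
    A.det *
        (A.submatrix (fun k : Fin n => k.succ.castSucc)
          (fun k : Fin n => k.succ.castSucc)).det =
      (A.submatrix (Fin.succAbove 0) (Fin.succAbove 0)).det *
          (A.submatrix (Fin.succAbove (Fin.last (n + 1)))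
            (Fin.succAbove (Fin.last (n + 1)))).det -
        (A.submatrix (Fin.succAbove (Fin.last (n + 1))) (Fin.succAbove 0)).det *
          (A.submatrix (Fin.succAbove 0) (Fin.succAbove (Fin.last (n + 1)))).det := by
  have generic := mul_left_cancel₀ (Matrix.det_mvPolynomialX_ne_zero (Fin (n + 2)) ℤ)
    (Matrix.det_mul_desnanot_jacobi (Matrix.mvPolynomialX (Fin (n + 2)) (Fin (n + 2)) ℤ))
  have h := congrArg (MvPolynomial.aeval fun p : Fin (n + 2) × Fin (n + 2) => A p.1 p.2) generic
  have hX : (Matrix.mvPolynomialX (Fin (n + 2)) (Fin (n + 2)) ℤ).map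
      (MvPolynomial.aeval fun p : Fin (n + 2) × Fin (n + 2) => A p.1 p.2) = A :=
    Matrix.mvPolynomialX_mapMatrix_aeval ℤ A
  simpa only [map_mul, map_sub, AlgHom.map_det, AlgHom.mapMatrix_apply, ← Matrix.submatrix_map,
    hX] using h
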